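/- Let n ≥ 3, −1 < α < ∞, p > 2 with 1/p + 1/p' = 1 and φ(p) = (p−2)/(p−1). Let ω be a weight on 𝔹_n with ω > 0 a.e. and [ω]_{p,α} < ∞, let K > 0, and let H ≥ 0 be a measurable function on 𝔹_n satisfying S_{ω,α}(H) ≤ K·H a.e. on 𝔹_n, where S_{ω,α}(H) = (M_α(H^{1/φ(p)} ω)/ω)^{φ(p)}. Then the weight Hω belongs to the Bekollé–Bonami class B_{2,α} with [Hω]_{2,α} ≤ K·[ω]_{p,α}^{1/(p−1)}. -/

import Mathlib

open MeasureTheory Metric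
open scoped ENNReal RealInnerProductSpace

noncomputable section

abbrev Eucl (n : ℕ) : Type := EuclideanSpace ℝ (Fin n)

/-- The spherical (angular) distance `ρ(x,y) = arccos ⟨x,y⟩`. -/
def rho {n : ℕ} (x y : Eucl n) : ℝ := Real.arccos ⟪x, y⟫

/-- The (unnormalized) weighted measure `(1-|x|²)^α dν` on the unit ball. -/
def muA (n : ℕ) (α : ℝ) : Measure (Eucl n) :=
  (volume.restrict (ball (0 : Eucl n) 1)).withDensity
    fun x => ENNReal.ofReal ((1 - ‖x‖ ^ 2) ^ α)

/-- The normalized weighted measure `ν_α` with `ν_α(𝔹_n) = 1`. -/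
def nuA (n : ℕ) (α : ℝ) : Measure (Eucl n) := (muA n α Set.univ)⁻¹ • muA n α

/-- The spherical ball `B_ρ(x,r)` on the unit sphere. -/
def sBall {n : ℕ} (x : Eucl n) (r : ℝ) : Set (Eucl n) := {y | ‖y‖ = 1 ∧ rho x y < r}

/-- The Carleson box of the spherical ball `B_ρ(x,r)`. -/
def cBoxBall {n : ℕ} (x : Eucl n) (r : ℝ) : Set (Eucl n) :=
  {z | ‖z‖ < 1 ∧ 1 - r < ‖z‖ ∧ ‖z‖⁻¹ • z ∈ sBall x r}

/-- The `ρ`-diameter of a subset of the sphere. -/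
def diamRho {n : ℕ} (Q : Set (Eucl n)) : ℝ :=
  sSup {d | ∃ x ∈ Q, ∃ y ∈ Q, d = rho x y}

/-- The Carleson box of a subset `Q` of the sphere. -/
def cBox {n : ℕ} (Q : Set (Eucl n)) : Set (Eucl n) :=
  {z | ‖z‖ < 1 ∧ 1 - diamRho Q / 2 < ‖z‖ ∧ ‖z‖⁻¹ • z ∈ Q}

/-- The `ε`-Carleson box of a subset `Q` of the sphere. -/
def cBoxEps {n : ℕ} (ε : ℝ) (Q : Set (Eucl n)) : Set (Eucl n) :=
  {z | ‖z‖ < 1 ∧ 1 - ε * diamRho Q / 2 < ‖z‖ ∧ ‖z‖⁻¹ • z ∈ Q}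

/-- `|S|_{ω,α} = ∫_S ω dν_α`. -/
def wInt {n : ℕ} (α : ℝ) (ω : Eucl n → ℝ) (S : Set (Eucl n)) : ℝ≥0∞ :=
  ∫⁻ x in S, ENNReal.ofReal (ω x) ∂(nuA n α)

/-- The Bekollé–Bonami constant `[ω]_{p,α}` (with `p' = p/(p-1)`). -/
def BB (n : ℕ) (p α : ℝ) (ω : Eucl n → ℝ) : ℝ≥0∞ :=
  ⨆ (x : Eucl n) (_ : ‖x‖ = 1) (r : ℝ) (_ : 0 < r) (_ : r < 1),
    (wInt α ω (cBoxBall x r) / nuA n α (cBoxBall x r)) *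
      (wInt α (fun y => ω y ^ (1 - p / (p - 1))) (cBoxBall x r) /
        nuA n α (cBoxBall x r)) ^ (p - 1)

/-- The maximal operator `M_α` over Carleson boxes of spherical balls. -/
def maxOp (n : ℕ) (α : ℝ) (f : Eucl n → ℝ) (x : Eucl n) : ℝ≥0∞ :=
  ⨆ (ξ : Eucl n) (_ : ‖ξ‖ = 1) (r : ℝ) (_ : 0 < r) (_ : r < 1),
    (cBoxBall ξ r).indicator
      (fun _ => (∫⁻ y in cBoxBall ξ r, ENNReal.ofReal |f y| ∂(nuA n α)) /
        nuA n α (cBoxBall ξ r)) x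

/-- The `L^q(ω dν_α)` "norm" of an `ℝ≥0∞`-valued function. -/
def pnormW (n : ℕ) (α q : ℝ) (ω : Eucl n → ℝ) (F : Eucl n → ℝ≥0∞) : ℝ≥0∞ :=
  (∫⁻ x, F x ^ q * ENNReal.ofReal (ω x) ∂(nuA n α)) ^ (1 / q)

/-- The operator `S_{ω,α}(h) = (M_α(h^{1/φ} ω)/ω)^φ`. -/
def sOp (n : ℕ) (α φ : ℝ) (ω h : Eucl n → ℝ) (x : Eucl n) : ℝ≥0∞ :=
  (maxOp n α (fun y => h y ^ (1 / φ) * ω y) x / ENNReal.ofReal (ω x)) ^ φ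

/-- Carleson boxes of spherical balls are measurable. -/
theorem measurableSet_cBoxBall {n : ℕ} (x : Eucl n) (r : ℝ) : MeasurableSet (cBoxBall x r) := by
  have hnorm : Measurable fun z : Eucl n => ‖z‖ := measurable_norm
  have hdir : Measurable fun z : Eucl n => ‖z‖⁻¹ • z := hnorm.inv.smul measurable_id
  have hrho : Measurable fun z : Eucl n => rho x (‖z‖⁻¹ • z) :=
    Real.continuous_arccos.measurable.comp (measurable_const.inner hdir)
  exact (measurableSet_lt hnorm measurable_const).inter
    ((measurableSet_lt measurable_const hnorm).inter
      ((measurableSet_eq_fun hdir.norm measurable_const).inter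
        (measurableSet_lt hrho measurable_const)))

/-- The average of `|f|` over a Carleson box bounds `M_α f` from below on that box. -/
theorem average_le_maxOp {n : ℕ} {α : ℝ} (f : Eucl n → ℝ) {ξ : Eucl n} (hξ : ‖ξ‖ = 1) {r : ℝ}
    (hr : 0 < r) (hr1 : r < 1) {x : Eucl n} (hx : x ∈ cBoxBall ξ r) :
    (∫⁻ y in cBoxBall ξ r, ENNReal.ofReal |f y| ∂(nuA n α)) / nuA n α (cBoxBall ξ r) ≤
      maxOp n α f x := by
  refine le_trans ?_ (le_iSup_of_le ξ <| le_iSup_of_le hξ <| le_iSup_of_le r <|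
    le_iSup_of_le hr <| le_iSup_of_le hr1 le_rfl)
  rw [Set.indicator_of_mem hx]

/-- Hölder's inequality for averages: the average of `hω` is at most the product of the
`φ`-th power of the average of `h^{1/φ} ω` and the `(1-φ)`-th power of the average of `ω`. -/
theorem average_mul_le_rpow_mul_rpow {X : Type*} [MeasurableSpace X] {μ : Measure X} {φ : ℝ}
    (hφ0 : 0 < φ) (hφ1 : φ < 1) {h ω : X → ℝ} (hm : Measurable h) (ωm : Measurable ω)
    (h0 : ∀ x, 0 ≤ h x) (ω0 : ∀ᵐ x ∂μ, 0 < ω x) (V : ℝ≥0∞) :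
    (∫⁻ x, ENNReal.ofReal (h x * ω x) ∂μ) / V ≤
      ((∫⁻ x, ENNReal.ofReal |h x ^ (1 / φ) * ω x| ∂μ) / V) ^ φ *
        ((∫⁻ x, ENNReal.ofReal (ω x) ∂μ) / V) ^ (1 - φ) := by
  have hpt : ∀ᵐ x ∂μ, ENNReal.ofReal (h x * ω x) =
      ENNReal.ofReal |h x ^ (1 / φ) * ω x| ^ φ * ENNReal.ofReal (ω x) ^ (1 - φ) := by
    filter_upwards [ω0] with x hx
    have hH : 0 ≤ h x ^ (1 / φ) := Real.rpow_nonneg (h0 x) _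
    rw [abs_of_nonneg (mul_nonneg hH hx.le),
      ENNReal.ofReal_rpow_of_nonneg (mul_nonneg hH hx.le) hφ0.le,
      ENNReal.ofReal_rpow_of_nonneg hx.le (by linarith), ← ENNReal.ofReal_mul (by positivity),
      Real.mul_rpow hH hx.le, ← Real.rpow_mul (h0 x), one_div_mul_cancel hφ0.ne', Real.rpow_one,
      mul_assoc, ← Real.rpow_add hx, add_sub_cancel, Real.rpow_one]
  have hV : V⁻¹ = V⁻¹ ^ φ * V⁻¹ ^ (1 - φ) := by
    rw [← ENNReal.rpow_add_of_nonneg _ _ hφ0.le (by linarith), add_sub_cancel, ENNReal.rpow_one]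
  have key := ENNReal.lintegral_mul_norm_pow_le (μ := μ) (p := φ) (q := 1 - φ)
    (f := fun x => ENNReal.ofReal |h x ^ (1 / φ) * ω x|) (g := fun x => ENNReal.ofReal (ω x))
    (by fun_prop) (by fun_prop) hφ0.le (by linarith) (by ring)
  rw [lintegral_congr_ae hpt]
  simp only [ENNReal.div_eq_inv_mul]
  rw [ENNReal.mul_rpow_of_nonneg _ _ hφ0.le, ENNReal.mul_rpow_of_nonneg _ _ (by linarith),
    mul_mul_mul_comm, ← hV]
  exact mul_le_mul_right key _

/-- The pointwise consequence of `(A/ω)^φ ≤ K h` for the dual weight of `hω`. -/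
theorem ofReal_inv_mul_le {A : ℝ≥0∞} (hA0 : A ≠ 0) (hA : A ≠ ⊤) {φ K h w : ℝ}
    (hK : 0 < K) (hw : 0 < w)
    (hle : (A / ENNReal.ofReal w) ^ φ ≤ ENNReal.ofReal (K * h)) :
    ENNReal.ofReal (h * w)⁻¹ ≤ ENNReal.ofReal K * (A ^ φ)⁻¹ * ENNReal.ofReal (w ^ (φ - 1)) := by
  lift A to NNReal using hA
  have ha : (0 : ℝ) < A := by
    simpa [pos_iff_ne_zero] using hA0
  rw [← ENNReal.ofReal_coe_nnreal] at hle ⊢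
  rw [← ENNReal.ofReal_div_of_pos hw, ENNReal.ofReal_rpow_of_pos (div_pos ha hw)] at hle
  have hpos : 0 < ((A : ℝ) / w) ^ φ := Real.rpow_pos_of_pos (div_pos ha hw) _
  have hle' : ((A : ℝ) / w) ^ φ ≤ K * h := by
    by_contra! hlt
    exact absurd hle (not_le.2 ((ENNReal.ofReal_lt_ofReal_iff hpos).2 hlt))
  have hh : 0 < h := pos_of_mul_pos_right (hpos.trans_le hle') hK.le
  have haφ : 0 < (A : ℝ) ^ φ := Real.rpow_pos_of_pos ha _
  have hwφ : 0 < w ^ φ := Real.rpow_pos_of_pos hw _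
  rw [ENNReal.ofReal_rpow_of_pos ha, ← ENNReal.ofReal_inv_of_pos haφ,
    ← ENNReal.ofReal_mul hK.le, ← ENNReal.ofReal_mul (by positivity)]
  refine ENNReal.ofReal_le_ofReal ?_
  rw [Real.div_rpow ha.le hw.le, div_le_iff₀ hwφ] at hle'
  rw [Real.rpow_sub_one hw.ne', inv_le_iff_one_le_mul₀ (by positivity)]
  calc (1 : ℝ) = (A : ℝ) ^ φ * ((A : ℝ) ^ φ)⁻¹ := (mul_inv_cancel₀ haφ.ne').symm
    _ ≤ K * h * w ^ φ * ((A : ℝ) ^ φ)⁻¹ := by gcongr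
    _ = _ := by field_simp

/-- if `S_{ω,α}(H) ≤ K·H` a.e., then the weight `Hω` belongs to
`B_{2,α}` with `[Hω]_{2,α} ≤ K·[ω]_{p,α}^{1/(p−1)}`, where `φ(p) = (p−2)/(p−1)`. -/
theorem stmt18 (n : ℕ) (hn : 3 ≤ n) (α : ℝ) (hα : -1 < α) (p : ℝ) (hp : 2 < p)
    (ω : Eucl n → ℝ) (hωm : Measurable ω) (hωpos : ∀ᵐ x ∂nuA n α, 0 < ω x)
    (hBB : BB n p α ω ≠ ⊤) (K : ℝ) (hK : 0 < K)
    (H : Eucl n → ℝ) (hHm : Measurable H) (hH0 : ∀ x, 0 ≤ H x)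
    (hSH : ∀ᵐ x ∂nuA n α,
      sOp n α ((p - 2) / (p - 1)) ω H x ≤ ENNReal.ofReal (K * H x)) :
    BB n 2 α (fun x => H x * ω x) ≠ ⊤ ∧
      BB n 2 α (fun x => H x * ω x) ≤
        ENNReal.ofReal K * BB n p α ω ^ (1 / (p - 1)) := by
  have hp1 : 0 < p - 1 := by linarith
  set φ : ℝ := (p - 2) / (p - 1) with hφ
  have hφ0 : 0 < φ := div_pos (by linarith) hp1
  have hφ1 : 1 - φ = 1 / (p - 1) := by rw [hφ]; field_simp; ring
  have hφlt : φ < 1 := by have := one_div_pos.2 hp1; linarith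
  have hdual : 1 - p / (p - 1) = φ - 1 := by rw [hφ]; field_simp; ring
  have hbound : BB n 2 α (fun x => H x * ω x) ≤
      ENNReal.ofReal K * BB n p α ω ^ (1 / (p - 1)) := by
    refine iSup_le fun ξ => iSup_le fun hξ => iSup_le fun r => iSup_le fun hr =>
      iSup_le fun hr1 => ?_
    set B := cBoxBall ξ r with hB
    set V := nuA n α B with hV
    set A := (∫⁻ y in B, ENNReal.ofReal |H y ^ (1 / φ) * ω y| ∂(nuA n α)) / V with hA
    have hold : wInt α (fun x => H x * ω x) B / V ≤ A ^ φ * (wInt α ω B / V) ^ (1 - φ) :=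
      average_mul_le_rpow_mul_rpow hφ0 hφlt hHm hωm hH0 (ae_restrict_of_ae hωpos) V
    have hpt : ∀ᵐ x ∂(nuA n α).restrict B, 0 < ω x ∧
        (A / ENNReal.ofReal (ω x)) ^ φ ≤ ENNReal.ofReal (K * H x) := by
      filter_upwards [ae_restrict_mem (measurableSet_cBoxBall ξ r), ae_restrict_of_ae hωpos,
        ae_restrict_of_ae hSH] with x hxB hx hS
      refine ⟨hx, le_trans ?_ hS⟩
      unfold sOp
      gcongr
      exact average_le_maxOp (fun y => H y ^ (1 / φ) * ω y) hξ hr hr1 hxB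
    by_cases hA0 : A = 0
    · rw [hA0, ENNReal.zero_rpow_of_pos hφ0, zero_mul, nonpos_iff_eq_zero] at hold
      rw [hold, zero_mul]
      exact zero_le
    have hAtop : A ≠ ⊤ := by
      intro htop
      have hfalse : ∀ᵐ x ∂(nuA n α).restrict B, False := by
        filter_upwards [hpt] with x hx
        have hle := hx.2
        rw [htop, ENNReal.top_div_of_ne_top ENNReal.ofReal_ne_top,
          ENNReal.top_rpow_of_pos hφ0] at hle
        exact ENNReal.ofReal_ne_top (top_le_iff.1 hle)
      have hzero : (nuA n α).restrict B = 0 := by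
        rwa [Filter.eventually_false_iff_eq_bot, ae_eq_bot] at hfalse
      exact hA0 (by rw [hA, hzero, lintegral_zero_measure, ENNReal.zero_div])
    have hinv : wInt α (fun y => (H y * ω y) ^ ((1 : ℝ) - 2 / (2 - 1))) B ≤
        ENNReal.ofReal K * (A ^ φ)⁻¹ * wInt α (fun y => ω y ^ (1 - p / (p - 1))) B := by
      unfold wInt
      rw [← lintegral_const_mul _ (by fun_prop)]
      refine lintegral_mono_ae ?_
      filter_upwards [hpt] with x hx
      rw [show (1 : ℝ) - 2 / (2 - 1) = -1 by norm_num, Real.rpow_neg_one, hdual]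
      exact ofReal_inv_mul_le hA0 hAtop hK hx.1 hx.2
    have hAφ0 : A ^ φ ≠ 0 := by simp [ENNReal.rpow_eq_zero_iff, hA0, hAtop]
    have hAφtop : A ^ φ ≠ ⊤ := ENNReal.rpow_ne_top_of_nonneg hφ0.le hAtop
    set W := wInt α ω B / V
    set S := wInt α (fun y => ω y ^ (1 - p / (p - 1))) B / V with hS
    have hWS : W * S ^ (p - 1) ≤ BB n p α ω :=
      le_iSup_of_le ξ <| le_iSup_of_le hξ <| le_iSup_of_le r <| le_iSup_of_le hr <|
        le_iSup_of_le hr1 le_rfl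
    rw [show (2 : ℝ) - 1 = 1 by norm_num, ENNReal.rpow_one]
    rw [show (2 : ℝ) - 1 = 1 by norm_num] at hinv
    calc _ ≤ (A ^ φ * W ^ (1 - φ)) * (ENNReal.ofReal K * (A ^ φ)⁻¹ *
          wInt α (fun y => ω y ^ (1 - p / (p - 1))) B / V) := by gcongr
      _ = (A ^ φ * (A ^ φ)⁻¹) * (ENNReal.ofReal K * (W ^ (1 - φ) * S)) := by
          rw [hS, mul_div_assoc]; ring
      _ = ENNReal.ofReal K * (W * S ^ (p - 1)) ^ (1 / (p - 1)) := by
          rw [ENNReal.mul_inv_cancel hAφ0 hAφtop, one_mul, hφ1,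
            ENNReal.mul_rpow_of_nonneg _ _ (one_div_pos.2 hp1).le, ← ENNReal.rpow_mul,
            mul_one_div_cancel hp1.ne', ENNReal.rpow_one]
      _ ≤ _ := by gcongr
  exact ⟨ne_top_of_le_ne_top (ENNReal.mul_ne_top ENNReal.ofReal_ne_top
    (ENNReal.rpow_ne_top_of_nonneg (one_div_pos.2 hp1).le hBB)) hbound, hbound⟩
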